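/- arXiv:1403.1538 — 3 statements merged into one kernel-verified Lean document; each statement's English description precedes it below -/
import Mathlib

section
/- Let W ∈ C¹(ℝᵐ;ℝ), m ≥ 1, be nonnegative with W(u) > 0 for all u ≠ a and W(a) = 0 for some point a ∈ ℝᵐ. If u ∈ C²(ℝⁿ;ℝᵐ), n ≥ 2, is a bounded, globally minimizing solution of the system Δu = ∇W(u) on ℝⁿ, then (1/R^{n-1}) · ∫_{B_R} ( (1/2)|∇u|² + W(u) ) dx → 0 as R → ∞, where B_R is the ball of radius R centered at the origin. -/
open MeasureTheory Metric Filter RealInnerProductSpace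

/-- Squared Frobenius norm of the gradient: `|∇u|² = Σᵢ |u_{xᵢ}|²`. -/
noncomputable def gradSq {n m : ℕ}
    (u : EuclideanSpace ℝ (Fin n) → EuclideanSpace ℝ (Fin m))
    (x : EuclideanSpace ℝ (Fin n)) : ℝ :=
  ∑ i : Fin n, ‖fderiv ℝ u x (EuclideanSpace.single i 1)‖ ^ 2

/-- The Laplacian of `u`, computed componentwise: `Δu = Σᵢ u_{xᵢxᵢ}`. -/
noncomputable def vlap {n m : ℕ}
    (u : EuclideanSpace ℝ (Fin n) → EuclideanSpace ℝ (Fin m))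
    (x : EuclideanSpace ℝ (Fin n)) : EuclideanSpace ℝ (Fin m) :=
  ∑ i : Fin n,
    fderiv ℝ (fun y => fderiv ℝ u y (EuclideanSpace.single i 1)) x (EuclideanSpace.single i 1)

/-- The Allen–Cahn energy `E(u;Ω) = ∫_Ω ((1/2)|∇u|² + W(u)) dx`. -/
noncomputable def energy {n m : ℕ} (W : EuclideanSpace ℝ (Fin m) → ℝ)
    (u : EuclideanSpace ℝ (Fin n) → EuclideanSpace ℝ (Fin m))
    (Ω : Set (EuclideanSpace ℝ (Fin n))) : ℝ :=
  ∫ x in Ω, ((1 / 2) * gradSq u x + W (u x))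

/-- `u` is a globally minimizing solution: for every bounded domain `Ω` and every
perturbation `φ ∈ W^{1,2}_0(Ω;ℝᵐ) ∩ L^∞(Ω;ℝᵐ)` (encoded as a Lipschitz, hence
bounded and `W^{1,2}`, function supported in `Ω`), `E(u;Ω) ≤ E(u+φ;Ω)`. -/
def GloballyMinimizing {n m : ℕ} (W : EuclideanSpace ℝ (Fin m) → ℝ)
    (u : EuclideanSpace ℝ (Fin n) → EuclideanSpace ℝ (Fin m)) : Prop :=
  ∀ Ω : Set (EuclideanSpace ℝ (Fin n)), IsOpen Ω → Bornology.IsBounded Ω →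
    ∀ φ : EuclideanSpace ℝ (Fin n) → EuclideanSpace ℝ (Fin m),
      (∃ K : NNReal, LipschitzWith K φ) → tsupport φ ⊆ Ω →
      energy W u Ω ≤ energy W (u + φ) Ω

/-- Smooth radial function used instead of the norm. -/
noncomputable def rho {n : ℕ} (x : EuclideanSpace ℝ (Fin n)) : ℝ := Real.sqrt (1 + ‖x‖ ^ 2)

lemma rho_contDiff {n : ℕ} : ContDiff ℝ 2 (rho (n := n)) := by
  unfold rho
  refine ContDiff.sqrt (contDiff_const.add (contDiff_norm_sq ℝ)) ?_
  intro x
  positivity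

lemma norm_le_rho {n : ℕ} (x : EuclideanSpace ℝ (Fin n)) : ‖x‖ ≤ rho x := by
  unfold rho
  apply Real.le_sqrt_of_sq_le
  linarith

lemma rho_le {n : ℕ} (x : EuclideanSpace ℝ (Fin n)) : rho x ≤ 1 + ‖x‖ := by
  unfold rho
  apply Real.sqrt_le_iff.2
  constructor
  · positivity
  · nlinarith [norm_nonneg x]

lemma rho_lip {n : ℕ} : LipschitzWith 1 (rho (n := n)) := by
  apply LipschitzWith.of_le_add
  intro x y
  have h1 : ‖x‖ ≤ ‖y‖ + dist x y := by
    rw [dist_eq_norm]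
    have := norm_add_le y (x - y)
    simpa using this
  have h2 := norm_le_rho y
  have h3 : rho y ^ 2 = 1 + ‖y‖ ^ 2 := by
    unfold rho
    exact Real.sq_sqrt (by positivity)
  have hd : 0 ≤ dist x y := dist_nonneg
  have h0 : 0 ≤ rho y := Real.sqrt_nonneg _
  show Real.sqrt (1 + ‖x‖ ^ 2) ≤ _
  apply Real.sqrt_le_iff.2
  constructor
  · positivity
  · nlinarith [norm_nonneg x, norm_nonneg y, mul_le_mul_of_nonneg_right h2 hd,
      pow_le_pow_left₀ (norm_nonneg x) h1 2]

lemma smoothTransition_lip : ∃ L : NNReal, LipschitzWith L Real.smoothTransition := by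
  have hc : ContDiff ℝ 1 Real.smoothTransition := Real.smoothTransition.contDiff
  have hd : Continuous (deriv Real.smoothTransition) := hc.continuous_deriv le_rfl
  obtain ⟨C, hC⟩ := (isCompact_Icc (a := (0:ℝ)) (b := 1)).exists_bound_of_continuousOn
    hd.continuousOn
  refine ⟨Real.toNNReal (max C 0), ?_⟩
  apply lipschitzWith_of_nnnorm_deriv_le (hc.differentiable one_ne_zero)
  intro x
  rw [← NNReal.coe_le_coe]
  rw [Real.coe_toNNReal _ (le_max_right _ _), coe_nnnorm]
  by_cases hx : x ∈ Set.Icc (0:ℝ) 1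
  · exact (hC x hx).trans (le_max_left _ _)
  · have : deriv Real.smoothTransition x = 0 := by
      rw [Set.mem_Icc, not_and_or, not_le, not_le] at hx
      rcases hx with hx | hx
      · have : Real.smoothTransition =ᶠ[nhds x] fun _ => (0:ℝ) := by
          filter_upwards [Iio_mem_nhds hx] with y hy
          exact Real.smoothTransition.zero_of_nonpos (le_of_lt hy)
        rw [this.deriv_eq]; simp
      · have : Real.smoothTransition =ᶠ[nhds x] fun _ => (1:ℝ) := by
          filter_upwards [Ioi_mem_nhds hx] with y hy
          exact Real.smoothTransition.one_of_one_le (le_of_lt hy)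
        rw [this.deriv_eq]; simp
    rw [this]; simp

/-- sublevel sets -/
def subl (n : ℕ) (r : ℝ) : Set (EuclideanSpace ℝ (Fin n)) := {x | rho x < r}

lemma subl_open (n : ℕ) (r : ℝ) : IsOpen (subl n r) :=
  isOpen_lt rho_contDiff.continuous continuous_const

lemma subl_ball (n : ℕ) (r : ℝ) : subl n r ⊆ ball 0 r := by
  intro x hx
  rw [mem_ball_zero_iff]
  exact (norm_le_rho x).trans_lt hx

lemma ball_subl (n : ℕ) (r : ℝ) : ball 0 r ⊆ subl n (r + 1) := by
  intro x hx
  rw [mem_ball_zero_iff] at hx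
  have := rho_le x
  show rho x < r + 1
  linarith

lemma alg_ineq (s x y : ℝ) (h0 : 0 ≤ s) (h1 : s ≤ 1) (hx : 0 ≤ x) (hy : 0 ≤ y) :
    ((1 - s ^ 2) * x + 2 * s * y) ^ 2 ≤ x ^ 2 + 8 * y ^ 2 := by
  have hs : s ^ 2 ≤ 1 := by nlinarith
  have e1 : 0 ≤ s ^ 2 * (1 - s ^ 2) * x ^ 2 := by
    have : 0 ≤ 1 - s ^ 2 := by linarith
    positivity
  have e2 : 0 ≤ s ^ 3 * (x * y) := by positivity
  have e3 : 0 ≤ (1 - s ^ 2) * y ^ 2 := by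
    have : 0 ≤ 1 - s ^ 2 := by linarith
    positivity
  nlinarith [sq_nonneg (s * x - 2 * y)]

lemma gradSq_cont {n m : ℕ} {u : EuclideanSpace ℝ (Fin n) → EuclideanSpace ℝ (Fin m)}
    (hu : ContDiff ℝ 2 u) : Continuous (gradSq u) := by
  unfold gradSq
  have : Continuous (fderiv ℝ u) := hu.continuous_fderiv (by norm_num)
  fun_prop

/-- energy density -/
noncomputable def dens {n m : ℕ} (W : EuclideanSpace ℝ (Fin m) → ℝ)
    (u : EuclideanSpace ℝ (Fin n) → EuclideanSpace ℝ (Fin m))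
    (x : EuclideanSpace ℝ (Fin n)) : ℝ := (1 / 2) * gradSq u x + W (u x)

lemma dens_cont {n m : ℕ} {W : EuclideanSpace ℝ (Fin m) → ℝ} (hW : ContDiff ℝ 1 W)
    {u : EuclideanSpace ℝ (Fin n) → EuclideanSpace ℝ (Fin m)}
    (hu : ContDiff ℝ 2 u) : Continuous (dens W u) := by
  unfold dens
  have := gradSq_cont hu
  have h2 := hW.continuous.comp hu.continuous
  exact (continuous_const.mul this).add h2

lemma gradSq_nonneg {n m : ℕ} (u : EuclideanSpace ℝ (Fin n) → EuclideanSpace ℝ (Fin m))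
    (x : EuclideanSpace ℝ (Fin n)) : 0 ≤ gradSq u x := by
  unfold gradSq
  positivity

lemma cont_intOn {n : ℕ} {f : EuclideanSpace ℝ (Fin n) → ℝ} (hf : Continuous f) (R : ℝ) :
    IntegrableOn f (ball 0 R) :=
  (hf.continuousOn.integrableOn_compact (isCompact_closedBall 0 R)).mono_set ball_subset_closedBall

lemma grad_comp {n m : ℕ} {L : NNReal} (a : EuclideanSpace ℝ (Fin m))
    {u : EuclideanSpace ℝ (Fin n) → EuclideanSpace ℝ (Fin m)} (hu : ContDiff ℝ 2 u)
    {η : EuclideanSpace ℝ (Fin n) → ℝ} (hη : ContDiff ℝ 2 η) (hL : LipschitzWith L η)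
    (x : EuclideanSpace ℝ (Fin n)) (h0 : 0 ≤ η x) (h1 : η x ≤ 1) :
    gradSq (u + fun x => -(η x ^ 2) • (u x - a)) x ≤ gradSq u x + 8 * n * L ^ 2 * ‖u x - a‖ ^ 2 ∧
    (η x = 0 → gradSq (u + fun x => -(η x ^ 2) • (u x - a)) x = gradSq u x) := by
  have du : HasFDerivAt u (fderiv ℝ u x) x :=
    (hu.differentiable (by norm_num) x).hasFDerivAt
  have dη : HasFDerivAt η (fderiv ℝ η x) x :=
    (hη.differentiable (by norm_num) x).hasFDerivAt
  have dv := du.add (((dη.pow 2).neg).smul (du.sub_const a))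
  have key : ∀ e, fderiv ℝ (u + fun x => -(η x ^ 2) • (u x - a)) x e =
      (1 - η x ^ 2) • fderiv ℝ u x e - (2 * η x * fderiv ℝ η x e) • (u x - a) := by
    intro e
    have := dv.fderiv
    erw [this]
    simp [sub_smul, mul_smul]
    module
  have hb : ∀ i : Fin n, |fderiv ℝ η x (EuclideanSpace.single i 1)| ≤ L := by
    intro i
    have := (fderiv ℝ η x).le_of_opNorm_le (norm_fderiv_le_of_lipschitz ℝ hL (x₀ := x))
      (EuclideanSpace.single i 1)
    simpa using this
  constructor
  · unfold gradSq
    have : ∀ i : Fin n, ‖fderiv ℝ (u + fun x => -(η x ^ 2) • (u x - a)) x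
        (EuclideanSpace.single i 1)‖ ^ 2 ≤
        ‖fderiv ℝ u x (EuclideanSpace.single i 1)‖ ^ 2 + 8 * (L * ‖u x - a‖) ^ 2 := by
      intro i
      rw [key]
      have hs : 0 ≤ 1 - η x ^ 2 := by nlinarith
      have hle : ‖(1 - η x ^ 2) • fderiv ℝ u x (EuclideanSpace.single i 1) -
          (2 * η x * fderiv ℝ η x (EuclideanSpace.single i 1)) • (u x - a)‖ ≤
          (1 - η x ^ 2) * ‖fderiv ℝ u x (EuclideanSpace.single i 1)‖ +
          2 * η x * (L * ‖u x - a‖) := by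
        refine (norm_sub_le _ _).trans ?_
        rw [norm_smul, norm_smul, Real.norm_of_nonneg hs, Real.norm_eq_abs, abs_mul,
          abs_of_nonneg (by positivity : 0 ≤ 2 * η x)]
        have := mul_le_mul_of_nonneg_left (mul_le_mul_of_nonneg_right (hb i)
          (norm_nonneg (u x - a))) (by positivity : 0 ≤ 2 * η x)
        linarith
      refine (pow_le_pow_left₀ (norm_nonneg _) hle 2).trans ?_
      exact alg_ineq _ _ _ h0 h1 (norm_nonneg _) (by positivity)
    refine (Finset.sum_le_sum fun i _ => this i).trans ?_
    rw [Finset.sum_add_distrib]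
    simp
    apply le_of_eq
    ring
  · intro h
    unfold gradSq
    simp only [key]
    simp [h]

lemma step {n m : ℕ} {L : NNReal} (hL : LipschitzWith L Real.smoothTransition)
    (W : EuclideanSpace ℝ (Fin m) → ℝ) (hW : ContDiff ℝ 1 W)
    (a : EuclideanSpace ℝ (Fin m))
    (hWa : W a = 0) (hW0 : ∀ v, 0 ≤ W v)
    (u : EuclideanSpace ℝ (Fin n) → EuclideanSpace ℝ (Fin m))
    (hu : ContDiff ℝ 2 u) (hmin : GloballyMinimizing W u) (α β : ℝ) (hβ : 0 ≤ β)
    (H : ∀ x, ∀ t ∈ Set.Icc (0:ℝ) 1,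
      4 * n * L ^ 2 * ‖u x - a‖ ^ 2 + W (a + t • (u x - a)) ≤ α + β * W (u x)) (r : ℝ) :
    energy W u (subl n r) ≤ α * (volume.real (subl n (r + 1)) - volume.real (subl n r)) +
      β * (energy W u (subl n (r + 1)) - energy W u (subl n r)) := by
  set η : EuclideanSpace ℝ (Fin n) → ℝ := fun x => Real.smoothTransition (r + 1 - rho x) with hηd
  have hη : ContDiff ℝ 2 η := Real.smoothTransition.contDiff.comp (contDiff_const.sub rho_contDiff)
  have hηL : LipschitzWith L η := by
    have h1 : LipschitzWith 1 (fun x : EuclideanSpace ℝ (Fin n) => r + 1 - rho x) := by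
      have := (LipschitzWith.const (α := EuclideanSpace ℝ (Fin n)) (r + 1)).sub rho_lip
      simpa using this
    have h2 := hL.comp h1
    rw [mul_one] at h2
    exact h2
  have hη0 : ∀ x, 0 ≤ η x := fun x => Real.smoothTransition.nonneg _
  have hη1 : ∀ x, η x ≤ 1 := fun x => Real.smoothTransition.le_one _
  set φ : EuclideanSpace ℝ (Fin n) → EuclideanSpace ℝ (Fin m) :=
    fun x => -(η x ^ 2) • (u x - a) with hφd
  have hφ : ContDiff ℝ 2 φ := ((hη.pow 2).neg).smul (hu.sub contDiff_const)
  have hts : tsupport φ ⊆ {x | rho x ≤ r + 1} := by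
    apply closure_minimal
    · intro x hx
      by_contra hcon
      apply hx
      have : η x = 0 := Real.smoothTransition.zero_of_nonpos (by
        have : r + 1 < rho x := not_le.1 hcon
        linarith)
      simp [hφd, this]
    · exact isClosed_le rho_contDiff.continuous continuous_const
  have hts2 : tsupport φ ⊆ closedBall 0 (r + 1) := by
    intro x hx
    rw [mem_closedBall_zero_iff]
    exact (norm_le_rho x).trans (hts hx)
  have hcs : HasCompactSupport φ :=
    (isCompact_closedBall 0 (r + 1)).of_isClosed_subset (isClosed_tsupport φ) hts2
  have hφL : ∃ K : NNReal, LipschitzWith K φ :=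
    ContDiff.lipschitzWith_of_hasCompactSupport hcs hφ (by norm_num)
  have hE := hmin (ball 0 (r + 2)) isOpen_ball isBounded_ball φ hφL
    (hts2.trans (closedBall_subset_ball (by linarith)))
  have hec := dens_cont hW hu
  have hecv := dens_cont hW (hu.add hφ)
  have hgc : Continuous (fun x => α + β * dens W u x) := by fun_prop
  have hd0 : ∀ x, 0 ≤ dens W u x := fun x => by
    have := gradSq_nonneg u x
    have := hW0 (u x)
    unfold dens; linarith
  have hpt : ∀ x, dens W (u + φ) x ≤ dens W u x - (subl n r).indicator (dens W u) x +
      ((subl n (r+1)).indicator (fun x => α + β * dens W u x) x -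
        (subl n r).indicator (fun x => α + β * dens W u x) x) := by
    intro x
    have hgr := grad_comp a hu hη hηL x (hη0 x) (hη1 x)
    rw [← hφd] at hgr
    by_cases h1 : rho x < r
    · have m1 : x ∈ subl n r := h1
      have m2 : x ∈ subl n (r + 1) := by show rho x < r + 1; linarith
      have hev : (u + φ) =ᶠ[nhds x] fun _ => a := by
        filter_upwards [(subl_open n r).mem_nhds m1] with y hy
        have hy' : rho y < r := hy
        have : η y = 1 := Real.smoothTransition.one_of_one_le (by linarith)
        simp [hφd, this]
      have hz : dens W (u + φ) x = 0 := by
        unfold dens gradSq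
        rw [hev.fderiv_eq, hev.eq_of_nhds]
        simp [hWa]
      simp [hz, m1, m2]
    · have m1 : x ∉ subl n r := h1
      by_cases h2 : rho x < r + 1
      · have m2 : x ∈ subl n (r + 1) := h2
        simp only [m1, m2, Set.indicator_of_mem, Set.indicator_of_notMem, not_false_eq_true]
        have hv : (u + φ) x = a + (1 - η x ^ 2) • (u x - a) := by
          simp only [Pi.add_apply, hφd]
          module
        have hH := H x (1 - η x ^ 2) ⟨by nlinarith [hη0 x, hη1 x], by nlinarith [hη0 x]⟩
        have hg0 := mul_nonneg hβ (gradSq_nonneg u x)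
        have hw := hW0 (u x)
        have := hgr.1
        unfold dens
        rw [hv]
        nlinarith
      · have m2 : x ∉ subl n (r + 1) := h2
        simp only [m1, m2, Set.indicator_of_notMem, not_false_eq_true]
        have he : η x = 0 := Real.smoothTransition.zero_of_nonpos (by linarith)
        have hv : (u + φ) x = u x := by simp [hφd, he]
        unfold dens
        rw [hv, hgr.2 he]
        simp
  have hs1 : subl n r ⊆ ball 0 (r + 2) := (subl_ball n r).trans (ball_subset_ball (by linarith))
  have hs2 : subl n (r + 1) ⊆ ball 0 (r + 2) :=
    (subl_ball n (r+1)).trans (ball_subset_ball (by linarith))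
  have me1 := (subl_open n r).measurableSet
  have me2 := (subl_open n (r+1)).measurableSet
  have i0 := cont_intOn hec (r + 2)
  have i1 : IntegrableOn ((subl n r).indicator (dens W u)) (ball 0 (r + 2)) := i0.indicator me1
  have ig := cont_intOn hgc (r + 2)
  have i2 : IntegrableOn ((subl n (r+1)).indicator (fun x => α + β * dens W u x))
    (ball 0 (r + 2)) := ig.indicator me2
  have i3 : IntegrableOn ((subl n r).indicator (fun x => α + β * dens W u x))
    (ball 0 (r + 2)) := ig.indicator me1
  have hcmp1 := setIntegral_mono (cont_intOn hecv (r+2)) ((i0.sub i1).add (i2.sub i3)) hpt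
  have hlin : ∀ s, s ≤ r + 1 → ∫ x in subl n s, (α + β * dens W u x) =
      α * volume.real (subl n s) + β * energy W u (subl n s) := by
    intro s hs
    have hss : subl n s ⊆ ball 0 (r + 2) := (subl_ball n s).trans (ball_subset_ball (by linarith))
    have c1 : IntegrableOn (fun _ : EuclideanSpace ℝ (Fin n) => α) (subl n s) :=
      (cont_intOn continuous_const (r+2)).mono_set hss
    have c2 : IntegrableOn (fun x => β * dens W u x) (subl n s) :=
      (cont_intOn (continuous_const.mul hec) (r+2)).mono_set hss
    rw [integral_add c1 c2, setIntegral_const, integral_const_mul, smul_eq_mul, mul_comm]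
    rfl
  have hsplit : ∫ x in ball 0 (r+2), (dens W u x - (subl n r).indicator (dens W u) x +
      ((subl n (r+1)).indicator (fun x => α + β * dens W u x) x -
        (subl n r).indicator (fun x => α + β * dens W u x) x)) =
      (energy W u (ball 0 (r+2)) - energy W u (subl n r)) +
      ((∫ x in subl n (r+1), (α + β * dens W u x)) - ∫ x in subl n r, (α + β * dens W u x)) := by
    refine (integral_add (i0.sub i1) (i2.sub i3)).trans ?_
    simp only [Pi.sub_apply]
    rw [integral_sub i0 i1, integral_sub i2 i3,
      setIntegral_indicator me1, setIntegral_indicator me2, setIntegral_indicator me1,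
      Set.inter_eq_self_of_subset_right hs1, Set.inter_eq_self_of_subset_right hs2]
    rfl
  have hcmp2 : energy W (u + φ) (ball 0 (r+2)) ≤ _ := hcmp1.trans_eq hsplit
  rw [hlin r (by linarith), hlin (r + 1) le_rfl] at hcmp2
  linarith

/-- Pure algebra: summing the one-step inequality. -/
lemma sum_step (F V : ℝ → ℝ) (hFm : Monotone F) (α β : ℝ)
    (h : ∀ r, F r ≤ α * (V (r+1) - V r) + β * (F (r+1) - F r)) (R : ℝ) (N : ℕ) :
    N * F R ≤ α * (V (R + N) - V R) + β * (F (R + N) - F R) := by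
  induction N with
  | zero => simp
  | succ k ih =>
    have h1 := h (R + k)
    have h2 : F R ≤ F (R + k) := hFm (by simp)
    push_cast
    rw [← add_assoc]
    linarith

lemma growth (d : ℕ) (F V : ℝ → ℝ) (hFm : Monotone F) (hF0 : ∀ r, 0 ≤ F r) (hV0 : ∀ r, 0 ≤ V r)
    (ω : ℝ) (hω : 0 ≤ ω) (hV : ∀ r, 0 ≤ r → V r ≤ ω * r ^ (d + 1))
    (K : ℝ) (hK : 0 ≤ K) (h1 : ∀ r, F r ≤ K * (V (r+1) - V r))
    (h2 : ∀ ε > 0, ∃ C ≥ 0, ∀ r, F r ≤ ε * (V (r+1) - V r) + C * (F (r+1) - F r)) :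
    Tendsto (fun R => F R / R ^ d) atTop (nhds 0) := by
  have avg : ∀ α β : ℝ, 0 ≤ α → 0 ≤ β →
      (∀ r, F r ≤ α * (V (r+1) - V r) + β * (F (r+1) - F r)) →
      ∀ R, 1 ≤ R → R * F R ≤ α * (ω * 3 ^ (d+1) * R ^ (d+1)) + β * F (3 * R) := by
    intro α β hα hβ h R hR
    have hs := sum_step F V hFm α β h R ⌈R⌉₊
    have hN1 : R ≤ ⌈R⌉₊ := Nat.le_ceil R
    have hN2 : (⌈R⌉₊ : ℝ) < R + 1 := Nat.ceil_lt_add_one (by linarith)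
    have a1 : R * F R ≤ ⌈R⌉₊ * F R := mul_le_mul_of_nonneg_right hN1 (hF0 R)
    have a2 : V (R + ⌈R⌉₊) ≤ ω * 3 ^ (d+1) * R ^ (d+1) := by
      refine (hV _ (by positivity)).trans ?_
      rw [mul_assoc, ← mul_pow]
      apply mul_le_mul_of_nonneg_left _ hω
      apply pow_le_pow_left₀ (by positivity)
      linarith
    have a3 : F (R + ⌈R⌉₊) ≤ F (3 * R) := hFm (by linarith)
    have a4 := mul_le_mul_of_nonneg_left (show V (R + ⌈R⌉₊) - V R ≤ ω * 3 ^ (d+1) * R ^ (d+1) by linarith [hV0 R]) hα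
    have a5 := mul_le_mul_of_nonneg_left (show F (R + ⌈R⌉₊) - F R ≤ F (3*R) by linarith [hF0 R]) hβ
    linarith
  have b1 : ∀ R, 1 ≤ R → F R ≤ K * ω * 3 ^ (d+1) * R ^ d := by
    intro R hR
    have := avg K 0 hK le_rfl (by simpa using h1) R hR
    have hR0 : 0 < R := by linarith
    refine le_of_mul_le_mul_left ?_ hR0
    rw [pow_succ] at this
    calc _ ≤ _ := this
      _ = _ := by ring
  rw [Metric.tendsto_atTop]
  intro ε hε
  set P : ℝ := ω * 3 ^ (d+1) with hP
  have hP0 : 0 ≤ P := by positivity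
  obtain ⟨C, hC, hstep⟩ := h2 (ε / (2 * (P + 1))) (by positivity)
  set Q : ℝ := C * (K * ω * 3 ^ (d+1) * 3 ^ d) with hQ
  have hQ0 : 0 ≤ Q := by positivity
  refine ⟨max 1 (2 * (Q + 1) / ε), fun R hR => ?_⟩
  have hR1 : 1 ≤ R := (le_max_left _ _).trans hR
  have hR2 : 2 * (Q + 1) / ε ≤ R := (le_max_right _ _).trans hR
  have hR0 : 0 < R := by linarith
  have hb := avg _ C (by positivity) hC hstep R hR1
  have h3 := mul_le_mul_of_nonneg_left (b1 (3 * R) (by linarith)) hC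
  have hRd : 0 < R ^ d := by positivity
  rw [Real.dist_eq, sub_zero, abs_of_nonneg (div_nonneg (hF0 R) hRd.le), div_lt_iff₀ hRd]
  refine lt_of_mul_lt_mul_left ?_ hR0.le
  have e1 : ε / (2 * (P + 1)) * (ω * 3 ^ (d+1) * R ^ (d+1)) ≤ ε / 2 * (R * R ^ d) := by
    rw [← hP]
    have : ε / (2 * (P + 1)) * P ≤ ε / 2 := by
      rw [div_mul_eq_mul_div, div_le_div_iff₀ (by positivity) (by positivity)]
      nlinarith
    calc _ = (ε / (2 * (P + 1)) * P) * (R * R ^ d) := by ring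
      _ ≤ _ := mul_le_mul_of_nonneg_right this (by positivity)
  have e2 : C * (K * ω * 3 ^ (d+1) * (3 * R) ^ d) = Q * R ^ d := by
    rw [hQ, mul_pow]; ring
  have e3 : Q < ε / 2 * R := by
    rw [div_le_iff₀ hε] at hR2
    linarith
  have e4 := mul_lt_mul_of_pos_right e3 hRd
  rw [e2] at h3
  calc R * F R ≤ _ := hb
    _ ≤ ε / 2 * (R * R ^ d) + Q * R ^ d := by linarith
    _ < ε / 2 * (R * R ^ d) + ε / 2 * R * R ^ d := by linarith
    _ = _ := by ring

lemma potential {m : ℕ} (W : EuclideanSpace ℝ (Fin m) → ℝ) (hW : Continuous W)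
    (a : EuclideanSpace ℝ (Fin m)) (hWa : W a = 0) (hWpos : ∀ v, v ≠ a → 0 < W v)
    (c M : ℝ) (hc : 0 ≤ c) :
    (∃ K ≥ 0, ∀ w, ‖w‖ ≤ M → ∀ t ∈ Set.Icc (0:ℝ) 1,
      c * ‖w - a‖ ^ 2 + W (a + t • (w - a)) ≤ K) ∧
    (∀ ε > 0, ∃ C ≥ 0, ∀ w, ‖w‖ ≤ M → ∀ t ∈ Set.Icc (0:ℝ) 1,
      c * ‖w - a‖ ^ 2 + W (a + t • (w - a)) ≤ ε + C * W w) := by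
  have hW0 : ∀ v, 0 ≤ W v := fun v => by
    by_cases h : v = a
    · rw [h, hWa]
    · exact (hWpos v h).le
  have hgc : Continuous (fun p : EuclideanSpace ℝ (Fin m) × ℝ =>
      c * ‖p.1 - a‖ ^ 2 + W (a + p.2 • (p.1 - a))) := by fun_prop
  have hK : ∃ K ≥ 0, ∀ w, ‖w‖ ≤ M → ∀ t ∈ Set.Icc (0:ℝ) 1,
      c * ‖w - a‖ ^ 2 + W (a + t • (w - a)) ≤ K := by
    obtain ⟨K, hK⟩ := ((isCompact_closedBall (0 : EuclideanSpace ℝ (Fin m)) M).prod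
      (isCompact_Icc (a := (0:ℝ)) (b := 1))).exists_bound_of_continuousOn hgc.continuousOn
    refine ⟨max K 0, le_max_right _ _, fun w hw t ht => ?_⟩
    have := hK (w, t) ⟨by simpa using hw, ht⟩
    exact ((le_abs_self _).trans this).trans (le_max_left _ _)
  refine ⟨hK, fun ε hε => ?_⟩
  obtain ⟨K, hK0, hK⟩ := hK
  have hlim : Tendsto (fun s : ℝ => c * s ^ 2) (nhds 0) (nhds 0) := by
    have : Continuous (fun s : ℝ => c * s ^ 2) := by fun_prop
    simpa using this.tendsto 0
  obtain ⟨δ₁, hδ₁, H₁⟩ := Metric.tendsto_nhds_nhds.1 hlim (ε / 2) (by positivity)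
  obtain ⟨δ₂, hδ₂, H₂⟩ := Metric.continuous_iff.1 hW a (ε / 2) (by positivity)
  set δ := min δ₁ δ₂ with hδ
  have hδ0 : 0 < δ := lt_min hδ₁ hδ₂
  have hcomp : IsCompact (closedBall (0 : EuclideanSpace ℝ (Fin m)) M ∩ {w | δ ≤ ‖w - a‖}) :=
    (isCompact_closedBall 0 M).inter_right (isClosed_le continuous_const (by fun_prop))
  have hmin : ∃ q > 0, ∀ w, ‖w‖ ≤ M → δ ≤ ‖w - a‖ → q ≤ W w := by
    rcases Set.eq_empty_or_nonempty
      (closedBall (0 : EuclideanSpace ℝ (Fin m)) M ∩ {w | δ ≤ ‖w - a‖}) with he | hne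
    · refine ⟨1, one_pos, fun w hw hw2 => ?_⟩
      have : w ∈ closedBall (0 : EuclideanSpace ℝ (Fin m)) M ∩ {w | δ ≤ ‖w - a‖} :=
        ⟨by simpa using hw, hw2⟩
      rw [he] at this
      exact this.elim
    · obtain ⟨w₀, hw₀, hm⟩ := hcomp.exists_isMinOn hne hW.continuousOn
      refine ⟨W w₀, hWpos _ ?_, fun w hw hw2 => hm ⟨by simpa using hw, hw2⟩⟩
      rintro rfl
      have := hw₀.2
      simp at this
      linarith
  obtain ⟨q, hq, hqW⟩ := hmin
  refine ⟨K / q, by positivity, fun w hw t ht => ?_⟩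
  by_cases hwd : δ ≤ ‖w - a‖
  · have h1 := hK w hw t ht
    have h2 := mul_le_mul_of_nonneg_left (hqW w hw hwd) (by positivity : 0 ≤ K / q)
    rw [div_mul_cancel₀ _ hq.ne'] at h2
    linarith
  · push Not at hwd
    have h1 := H₁ (x := ‖w - a‖) (by
      rw [Real.dist_eq, sub_zero, abs_of_nonneg (norm_nonneg _)]
      exact hwd.trans_le (min_le_left _ _))
    have h2 := H₂ (a + t • (w - a)) (by
      rw [dist_eq_norm, add_sub_cancel_left, norm_smul, Real.norm_of_nonneg ht.1]
      refine (mul_le_of_le_one_left (norm_nonneg _) ht.2).trans_lt ?_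
      exact hwd.trans_le (min_le_right _ _))
    rw [Real.dist_eq] at h1 h2
    have h1' := le_abs_self (c * ‖w - a‖ ^ 2 - 0)
    have h2' := le_abs_self (W (a + t • (w - a)) - W a)
    have h4 : 0 ≤ K / q * W w := mul_nonneg (by positivity) (hW0 w)
    linarith

/-- Theorem 1.1 (energy growth for minimizers of Allen–Cahn type systems):
the energy of a bounded globally minimizing solution over `B_R` is `o(R^{n-1})`. -/
theorem energy_growth_o_of_R_pow
    (n m : ℕ) (hn : 2 ≤ n) (hm : 1 ≤ m)
    (W : EuclideanSpace ℝ (Fin m) → ℝ) (hW : ContDiff ℝ 1 W)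
    (a : EuclideanSpace ℝ (Fin m))
    (hWa : W a = 0) (hWpos : ∀ v, v ≠ a → 0 < W v)
    (u : EuclideanSpace ℝ (Fin n) → EuclideanSpace ℝ (Fin m))
    (hu : ContDiff ℝ 2 u)
    (hbdd : ∃ C, ∀ x, ‖u x‖ ≤ C)
    (hsol : ∀ x, vlap u x = gradient W (u x))
    (hmin : GloballyMinimizing W u) :
    Tendsto (fun R : ℝ => (1 / R ^ (n - 1)) * energy W u (ball 0 R))
      atTop (nhds 0) := by
  obtain ⟨M, hM⟩ := hbdd
  obtain ⟨L, hL⟩ := smoothTransition_lip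
  have hW0 : ∀ v, 0 ≤ W v := fun v => by
    by_cases h : v = a
    · rw [h, hWa]
    · exact (hWpos v h).le
  obtain ⟨⟨K, hK0, hK⟩, hC⟩ := potential W hW.continuous a hWa hWpos (4 * n * L ^ 2) M (by positivity)
  have hd0 : ∀ x, 0 ≤ dens W u x := fun x => by
    have := gradSq_nonneg u x
    have := hW0 (u x)
    unfold dens; linarith
  have hec := dens_cont hW hu
  have hsubint : ∀ r, IntegrableOn (dens W u) (subl n r) := fun r =>
    (cont_intOn hec r).mono_set (subl_ball n r)
  have hmono : ∀ s t : Set (EuclideanSpace ℝ (Fin n)), s ⊆ t → IntegrableOn (dens W u) t →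
      energy W u s ≤ energy W u t := fun s t hst ht =>
    setIntegral_mono_set ht (Eventually.of_forall hd0) (LE.le.eventuallyLE hst)
  have hnn : ∀ s : Set (EuclideanSpace ℝ (Fin n)), 0 ≤ energy W u s := fun s =>
    integral_nonneg hd0
  have hnd : n - 1 + 1 = n := by omega
  have hg := growth (n - 1) (fun r => energy W u (subl n r)) (fun r => volume.real (subl n r))
    (fun r s hrs => hmono _ _ (fun x hx => lt_of_lt_of_le hx hrs) (hsubint s))
    (fun r => hnn _) (fun r => measureReal_nonneg)
    (volume.real (ball (0 : EuclideanSpace ℝ (Fin n)) 1)) measureReal_nonneg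
    (by
      intro r hr
      rw [hnd]
      have : Nonempty (Fin n) := ⟨⟨0, by omega⟩⟩
      have : Nontrivial (EuclideanSpace ℝ (Fin n)) :=
        Module.nontrivial_of_finrank_pos (R := ℝ) (by simp; omega)
      refine (measureReal_mono (subl_ball n r) measure_ball_lt_top.ne).trans ?_
      rw [Measure.real, Measure.addHaar_ball _ _ hr, ENNReal.toReal_mul,
        ENNReal.toReal_ofReal (by positivity), mul_comm]
      simp [Measure.real])
    K hK0
    (fun r => by
      have := step hL W hW a hWa hW0 u hu hmin K 0 le_rfl
        (fun x t ht => by simpa using hK (u x) (hM x) t ht) r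
      simpa using this)
    (fun ε hε => by
      obtain ⟨C, hC0, hC⟩ := hC ε hε
      exact ⟨C, hC0, fun r => step hL W hW a hWa hW0 u hu hmin ε C hC0
        (fun x t ht => hC (u x) (hM x) t ht) r⟩)
  have hg2 := (hg.comp (tendsto_atTop_add_const_right atTop (1:ℝ) tendsto_id)).const_mul
    ((2:ℝ) ^ (n - 1))
  rw [mul_zero] at hg2
  refine tendsto_of_tendsto_of_tendsto_of_le_of_le' tendsto_const_nhds hg2 ?_ ?_
  · filter_upwards [eventually_ge_atTop 1] with R hR
    have := hnn (ball 0 R)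
    have : 0 ≤ R := by linarith
    positivity
  · filter_upwards [eventually_ge_atTop 1] with R hR
    have h1 : energy W u (ball 0 R) ≤ energy W u (subl n (R + 1)) :=
      hmono _ _ (ball_subl n R) (hsubint _)
    have hR0 : 0 < R := by linarith
    simp only [Function.comp, id]
    rw [one_div_mul_eq_div, ← mul_div_assoc, div_le_div_iff₀ (by positivity) (by positivity)]
    have h2 : (R + 1) ^ (n - 1) ≤ 2 ^ (n - 1) * R ^ (n - 1) := by
      rw [← mul_pow]
      exact pow_le_pow_left₀ (by positivity) (by linarith) _
    calc _ ≤ energy W u (subl n (R + 1)) * (2 ^ (n - 1) * R ^ (n - 1)) :=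
          mul_le_mul h1 h2 (by positivity) (hnn _)
      _ = _ := by ring
end

section
/- Let m = 1 and let W ∈ C^{1,1}_{loc}(ℝ;ℝ) be nonnegative with W(u) > 0 for all u ≠ a and W(a) = 0 for some a ∈ ℝ. If u ∈ C²(ℝⁿ;ℝ), n ≥ 2, is a bounded, globally minimizing solution of Δu = W'(u) on ℝⁿ, then u ≡ a. -/
open MeasureTheory Metric Filter

/-- Squared norm of the gradient of a scalar function: `|∇u|² = Σᵢ |u_{xᵢ}|²`. -/
noncomputable def sgradSq {n : ℕ}
    (u : EuclideanSpace ℝ (Fin n) → ℝ)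
    (x : EuclideanSpace ℝ (Fin n)) : ℝ :=
  ∑ i : Fin n, ‖fderiv ℝ u x (EuclideanSpace.single i 1)‖ ^ 2

/-- The Laplacian of a scalar function: `Δu = Σᵢ u_{xᵢxᵢ}`. -/
noncomputable def slap {n : ℕ}
    (u : EuclideanSpace ℝ (Fin n) → ℝ)
    (x : EuclideanSpace ℝ (Fin n)) : ℝ :=
  ∑ i : Fin n,
    fderiv ℝ (fun y => fderiv ℝ u y (EuclideanSpace.single i 1)) x (EuclideanSpace.single i 1)

/-- The Allen–Cahn energy `E(u;Ω) = ∫_Ω ((1/2)|∇u|² + W(u)) dx`. -/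
noncomputable def senergy {n : ℕ} (W : ℝ → ℝ)
    (u : EuclideanSpace ℝ (Fin n) → ℝ)
    (Ω : Set (EuclideanSpace ℝ (Fin n))) : ℝ :=
  ∫ x in Ω, ((1 / 2) * sgradSq u x + W (u x))

/-- `u` is a globally minimizing solution (scalar case). -/
def SGloballyMinimizing {n : ℕ} (W : ℝ → ℝ)
    (u : EuclideanSpace ℝ (Fin n) → ℝ) : Prop :=
  ∀ Ω : Set (EuclideanSpace ℝ (Fin n)), IsOpen Ω → Bornology.IsBounded Ω →
    ∀ φ : EuclideanSpace ℝ (Fin n) → ℝ,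
      (∃ K : NNReal, LipschitzWith K φ) → tsupport φ ⊆ Ω →
      senergy W u Ω ≤ senergy W (u + φ) Ω

theorem sgradSq_nonneg' {n : ℕ} (u : EuclideanSpace ℝ (Fin n) → ℝ) (x) : 0 ≤ sgradSq u x :=
  Finset.sum_nonneg fun _ _ => by positivity

theorem sgradSq_le_of_norm {n : ℕ} (u : EuclideanSpace ℝ (Fin n) → ℝ) (x) (c : ℝ)
    (h : ‖fderiv ℝ u x‖ ≤ c) : sgradSq u x ≤ n * c ^ 2 := by
  unfold sgradSq
  calc _ ≤ ∑ _i : Fin n, c ^ 2 := by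
        refine Finset.sum_le_sum fun i _ => ?_
        have h1 := (fderiv ℝ u x).le_opNorm (EuclideanSpace.single i 1)
        simp only [EuclideanSpace.norm_single, norm_one, mul_one] at h1
        gcongr
        exact h1.trans h
    _ = _ := by simp

theorem sgradSq_congr {n : ℕ} {u v : EuclideanSpace ℝ (Fin n) → ℝ} {x}
    (h : fderiv ℝ u x = fderiv ℝ v x) : sgradSq u x = sgradSq v x := by
  simp [sgradSq, h]

/-- cutoff -/
noncomputable def cutS {n : ℕ} (R : ℝ) (x : EuclideanSpace ℝ (Fin n)) : ℝ :=
  min (max (‖x‖ - R) 0) 1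

theorem cutS_nonneg {n : ℕ} (R : ℝ) (x : EuclideanSpace ℝ (Fin n)) : 0 ≤ cutS R x := by
  simp [cutS]

theorem cutS_le_one {n : ℕ} (R : ℝ) (x : EuclideanSpace ℝ (Fin n)) : cutS R x ≤ 1 := by
  simp [cutS]

theorem cutS_lip {n : ℕ} (R : ℝ) (x y : EuclideanSpace ℝ (Fin n)) :
    |cutS R x - cutS R y| ≤ ‖x - y‖ := by
  have h := abs_norm_sub_norm_le x y
  refine le_trans ?_ h
  unfold cutS
  refine (abs_min_sub_min_le_max _ _ _ _).trans ?_
  simp only [sub_self, abs_zero]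
  refine max_le ((abs_max_sub_max_le_max _ _ _ _).trans ?_) (abs_nonneg _)
  simp

theorem cutS_zero {n : ℕ} (R : ℝ) (x : EuclideanSpace ℝ (Fin n)) (h : ‖x‖ ≤ R) :
    cutS R x = 0 := by
  simp [cutS, h]

theorem cutS_one {n : ℕ} (R : ℝ) (x : EuclideanSpace ℝ (Fin n)) (h : R + 1 ≤ ‖x‖) :
    cutS R x = 1 := by
  unfold cutS
  rw [max_eq_left (by linarith), min_eq_right (by linarith)]

noncomputable def barr {n : ℕ} (l K R : ℝ) (x : EuclideanSpace ℝ (Fin n)) : ℝ :=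
  l + K * cutS R x ^ 2

theorem barr_lip {n : ℕ} (l K R : ℝ) (hK : 0 ≤ K) (x y : EuclideanSpace ℝ (Fin n)) :
    |barr l K R x - barr l K R y| ≤ K * (cutS R x + cutS R y) * ‖x - y‖ := by
  have : barr l K R x - barr l K R y = K * (cutS R x + cutS R y) * (cutS R x - cutS R y) := by
    unfold barr; ring
  have h0 := cutS_nonneg R x
  have h1 := cutS_nonneg R y
  rw [this, abs_mul, abs_of_nonneg (by positivity)]
  gcongr
  exact cutS_lip R x y

theorem cutS_cont {n : ℕ} (R : ℝ) : Continuous (cutS R : EuclideanSpace ℝ (Fin n) → ℝ) := by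
  unfold cutS; fun_prop

theorem barr_cont {n : ℕ} (l K R : ℝ) :
    Continuous (barr l K R : EuclideanSpace ℝ (Fin n) → ℝ) := by
  have := cutS_cont (n := n) R
  unfold barr; fun_prop

theorem barr_fderiv {n : ℕ} (l K R : ℝ) (hK : 0 ≤ K) (x : EuclideanSpace ℝ (Fin n)) :
    ‖fderiv ℝ (barr l K R) x‖ ≤ K * (2 * cutS R x) := by
  have key : ∀ c > cutS R x, ‖fderiv ℝ (barr l K R) x‖ ≤ K * (c + cutS R x) := by
    intro c hc
    have h0 := cutS_nonneg R x
    refine norm_fderiv_le_of_lip' ℝ (by have := h0.trans hc.le; positivity) ?_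
    have := (cutS_cont (n := n) R).continuousAt.eventually (gt_mem_nhds hc)
    filter_upwards [this] with y hy
    refine (barr_lip l K R hK y x).trans ?_
    gcongr
  have hc : Tendsto (fun c => K * (c + cutS R x)) (nhdsWithin (cutS R x) (Set.Ioi (cutS R x)))
      (nhds (K * (cutS R x + cutS R x))) := by
    apply Tendsto.mono_left _ nhdsWithin_le_nhds
    apply Continuous.tendsto
    fun_prop
  have := ge_of_tendsto hc (by filter_upwards [self_mem_nhdsWithin] with c hc using key c hc)
  linarith

theorem barr_grad {n : ℕ} (l K R : ℝ) (hK : 0 ≤ K) (x : EuclideanSpace ℝ (Fin n)) :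
    (1 / 2) * sgradSq (barr l K R) x ≤ 2 * n * K * (barr l K R x - l) := by
  have := sgradSq_le_of_norm _ x _ (barr_fderiv l K R hK x)
  unfold barr at *
  nlinarith

/-- choice of level -/
theorem level_exists (W : ℝ → ℝ) (hW : Continuous W) (a M ε : ℝ) (haM : a ≤ M) (hε : 0 < ε)
    (hWa : W a = 0) (hWpos : ∀ v : ℝ, v ≠ a → 0 < W v) :
    ∃ l δ, a ≤ l ∧ l < a + ε ∧ l ≤ M ∧ 0 < δ ∧ ∀ t, l ≤ t → t ≤ M → δ * (t - l) ≤ W t - W l := by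
  obtain ⟨m, hm, hmW⟩ : ∃ m > 0, ∀ t ∈ Set.Icc (a + ε) M, m ≤ W t := by
    rcases (Set.Icc (a + ε) M).eq_empty_or_nonempty with h | h
    · exact ⟨1, one_pos, by simp [h]⟩
    · obtain ⟨t, ht, hmin⟩ := isCompact_Icc.exists_isMinOn h hW.continuousOn
      exact ⟨W t, hWpos t (by have := ht.1; intro h; linarith), fun s hs => hmin hs⟩
  set δ := m / (M - a + 1) with hδ
  have hpos : 0 < M - a + 1 := by linarith
  have hδ0 : 0 < δ := by positivity
  have hδm : δ * (M - a + 1) = m := by rw [hδ]; field_simp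
  obtain ⟨l, hl, hmin⟩ := (isCompact_Icc (a := a) (b := M)).exists_isMinOn ⟨a, le_refl _, haM⟩
    (f := fun t => W t - δ * (t - a)) (by fun_prop)
  refine ⟨l, δ, hl.1, ?_, hl.2, hδ0, ?_⟩
  · by_contra! hcon
    have h1 := hmW l ⟨hcon, hl.2⟩
    have h2 : W l - δ * (l - a) ≤ W a - δ * (a - a) := hmin ⟨le_refl _, haM⟩
    have h3 : δ * (l - a) ≤ δ * (M - a) := by gcongr; exact hl.2
    nlinarith
  · intro t h1 h2
    have h3 : W l - δ * (l - a) ≤ W t - δ * (t - a) := hmin ⟨hl.1.trans h1, h2⟩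
    linarith

/-- pointwise gradient of the minimum at a touching point -/
theorem grad_touch {n : ℕ} (u v : EuclideanSpace ℝ (Fin n) → ℝ) (x)
    (hu : DifferentiableAt ℝ u x) (hle : ∀ y, v y ≤ u y) (heq : v x = u x) :
    sgradSq v x ≤ sgradSq u x := by
  by_cases hv : DifferentiableAt ℝ v x
  · have hmin : IsLocalMin (fun y => u y - v y) x :=
      Eventually.of_forall fun y => by have := hle y; simp [heq]; linarith
    have h0 := hmin.fderiv_eq_zero
    rw [fderiv_fun_sub hu hv, sub_eq_zero] at h0
    exact (sgradSq_congr h0.symm).le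
  · have : sgradSq v x = 0 := by simp [sgradSq, fderiv_zero_of_not_differentiableAt hv]
    rw [this]; exact sgradSq_nonneg' u x

theorem perturb_lip {n : ℕ} (u : EuclideanSpace ℝ (Fin n) → ℝ) (hu : ContDiff ℝ 1 u)
    (l K R B : ℝ) (hK : 0 ≤ K) (hB : ∀ x, |min (u x) (barr l K R x) - u x| ≤ B)
    (h0 : ∀ x, R + 1 ≤ ‖x‖ → min (u x) (barr l K R x) - u x = 0) :
    ∃ k : NNReal, LipschitzWith k (fun x => min (u x) (barr l K R x) - u x) := by
  obtain ⟨A, hA⟩ := (isCompact_closedBall (0 : EuclideanSpace ℝ (Fin n)) (R + 2)).exists_bound_of_continuousOn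
    (hu.continuous_fderiv one_ne_zero).continuousOn
  have hB0 : 0 ≤ B := (abs_nonneg _).trans (hB 0)
  set k : ℝ := |A| + |A| + 2 * K + B with hk
  have hk0 : 0 ≤ k := by positivity
  refine ⟨⟨k, hk0⟩, LipschitzWith.of_dist_le_mul ?_⟩
  have huL : ∀ x y, ‖x‖ ≤ R + 2 → ‖y‖ ≤ R + 2 → |u x - u y| ≤ |A| * ‖x - y‖ := by
    intro x y hx hy
    have := (convex_closedBall (0 : EuclideanSpace ℝ (Fin n)) (R + 2)).norm_image_sub_le_of_norm_fderiv_le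
      (𝕜 := ℝ) (f := u) (C := |A|) (fun z _ => (hu.differentiable one_ne_zero) z)
      (fun z hz => (hA z hz).trans (le_abs_self A))
      (show y ∈ _ by simpa using hy) (show x ∈ _ by simpa using hx)
    simpa using this
  have one : ∀ x y, ‖x‖ ≤ R + 1 →
      |(min (u x) (barr l K R x) - u x) - (min (u y) (barr l K R y) - u y)| ≤ k * ‖x - y‖ := by
    intro x y hx
    have hn := norm_nonneg (x - y)
    by_cases hy : ‖y‖ ≤ R + 2
    · have h1 := huL x y (by linarith) hy
      have h2 := barr_lip l K R hK x y
      have h3 : |barr l K R x - barr l K R y| ≤ 2 * K * ‖x - y‖ := by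
        refine h2.trans ?_
        have := cutS_le_one R x
        have := cutS_le_one R y
        refine mul_le_mul_of_nonneg_right ?_ hn
        nlinarith
      have h4 := abs_min_sub_min_le_max (u x) (barr l K R x) (u y) (barr l K R y)
      have h5 : |min (u x) (barr l K R x) - min (u y) (barr l K R y)|
          ≤ |A| * ‖x - y‖ + 2 * K * ‖x - y‖ := by
        refine h4.trans (max_le ?_ ?_)
        · have : 0 ≤ 2 * K * ‖x - y‖ := by positivity
          linarith
        · have : 0 ≤ |A| * ‖x - y‖ := by positivity
          linarith
      have h6 : 0 ≤ B * ‖x - y‖ := by positivity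
      rw [show (min (u x) (barr l K R x) - u x) - (min (u y) (barr l K R y) - u y)
        = (min (u x) (barr l K R x) - min (u y) (barr l K R y)) - (u x - u y) by ring]
      refine (abs_sub _ _).trans ?_
      rw [hk]; nlinarith
    · push Not at hy
      rw [h0 y (by linarith), sub_zero]
      have h1 : 1 ≤ ‖x - y‖ := by
        have := norm_sub_norm_le y x
        rw [norm_sub_rev] at this
        linarith
      have h2 : B ≤ k := by rw [hk]; linarith [abs_nonneg A]
      calc _ ≤ B := hB x
        _ ≤ k * 1 := by linarith
        _ ≤ _ := by gcongr
  intro x y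
  rw [Real.dist_eq, dist_eq_norm]
  change _ ≤ k * _
  by_cases hx : ‖x‖ ≤ R + 1
  · exact one x y hx
  · by_cases hy : ‖y‖ ≤ R + 1
    · rw [abs_sub_comm, norm_sub_rev]; exact one y x hy
    · rw [h0 x (by linarith), h0 y (by linarith)]
      simp; positivity

theorem step_ineq {n : ℕ} (W : ℝ → ℝ) (hW : ContDiff ℝ 1 W) (hW0 : ∀ t, 0 ≤ W t)
    (u : EuclideanSpace ℝ (Fin n) → ℝ) (hu : ContDiff ℝ 1 u) (hmin : SGloballyMinimizing W u)
    (M l δ L K : ℝ) (hM : ∀ x, |u x| ≤ M) (hlM : l ≤ M) (hK : K = M - l)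
    (hlev : ∀ t, l ≤ t → t ≤ M → δ * (t - l) ≤ W t - W l) (hδ : 0 < δ)
    (hL0 : 0 ≤ L) (hL : ∀ t, l ≤ t → t ≤ M → W t - W l ≤ L * (t - l)) (R : ℝ) :
    (2 * n * K + L + δ) * ∫ x in ball (0 : EuclideanSpace ℝ (Fin n)) R, max (u x - l) 0
      ≤ (2 * n * K + L) * ∫ x in ball (0 : EuclideanSpace ℝ (Fin n)) (R + 1), max (u x - l) 0 := by
  set C := 2 * n * K + L with hC
  have hK0 : 0 ≤ K := by linarith
  have hC0 : 0 ≤ C := by positivity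
  set ψ := barr (n := n) l K R with hψ
  set φ : EuclideanSpace ℝ (Fin n) → ℝ := fun x => min (u x) (ψ x) - u x with hφ
  have hsum : u + φ = fun x => min (u x) (ψ x) := by ext x; simp [hφ]
  have hψl : ∀ x, l ≤ ψ x := by
    intro x; simp only [hψ, barr]; nlinarith [sq_nonneg (cutS R x)]
  have hout : ∀ x, R + 1 ≤ ‖x‖ → u x ≤ ψ x := by
    intro x hx
    simp only [hψ, barr, cutS_one R x hx]
    linarith [(abs_le.1 (hM x)).2]
  have h0 : ∀ x, R + 1 ≤ ‖x‖ → φ x = 0 := by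
    intro x hx; simp [hφ, min_eq_left (hout x hx)]
  have hφB : ∀ x, |φ x| ≤ M + |l| := by
    intro x
    have h1 := abs_le.1 (hM x)
    have h2 := hψl x
    have h3 := abs_nonneg l
    have h4 := neg_abs_le l
    simp only [hφ]
    rcases min_cases (u x) (ψ x) with ⟨h, h'⟩ | ⟨h, h'⟩ <;> rw [h, abs_le] <;>
      constructor <;> linarith
  have hlip := perturb_lip u hu l K R _ hK0 hφB h0
  set Ω := ball (0 : EuclideanSpace ℝ (Fin n)) (R + 2) with hΩ
  have hts : tsupport φ ⊆ Ω := by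
    refine (closure_minimal (t := closedBall 0 (R + 1)) ?_ isClosed_closedBall).trans
      (closedBall_subset_ball (by linarith))
    intro x hx
    by_contra hcon
    simp only [mem_closedBall, dist_zero_right, not_le] at hcon
    exact hx (h0 x hcon.le)
  have hE := hmin Ω isOpen_ball isBounded_ball φ hlip hts
  set w : EuclideanSpace ℝ (Fin n) → ℝ := fun x => max (u x - l) 0 with hw
  have hw0 : ∀ x, 0 ≤ w x := fun x => le_max_right _ _
  have hwc : Continuous w := by have := hu.continuous; fun_prop
  have hwi : ∀ r, IntegrableOn w (ball 0 r) := fun r =>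
    (hwc.continuousOn.integrableOn_compact (isCompact_closedBall 0 r)).mono_set ball_subset_closedBall
  set e1 : EuclideanSpace ℝ (Fin n) → ℝ := fun x => (1 / 2) * sgradSq u x + W (u x) with he1
  set e2 : EuclideanSpace ℝ (Fin n) → ℝ := fun x => (1 / 2) * sgradSq (u + φ) x + W ((u + φ) x) with he2
  set g : EuclideanSpace ℝ (Fin n) → ℝ := fun x => C * (ball 0 (R + 1)).indicator w x
    - (C + δ) * (ball 0 R).indicator w x with hg
  have hpt : ∀ x, e2 x ≤ e1 x + g x := by
    intro x
    rcases le_or_gt (u x) (ψ x) with hux | hux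
    · have hval : (u + φ) x = u x := by rw [hsum]; simp [hux]
      have hgr : sgradSq (u + φ) x ≤ sgradSq u x := by
        apply grad_touch _ _ _ (hu.differentiable one_ne_zero x) _ hval
        intro y; rw [hsum]; exact min_le_left _ _
      have hg0 : 0 ≤ g x := by
        simp only [hg]
        by_cases hx : x ∈ ball (0 : EuclideanSpace ℝ (Fin n)) R
        · have hψx : ψ x = l := by
            simp only [hψ, barr]; rw [cutS_zero R x (mem_ball_zero_iff.1 hx).le]; simp
          have : w x = 0 := by simp only [hw]; rw [max_eq_right]; linarith
          simp [Set.indicator, this]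
        · rw [Set.indicator_of_notMem hx]
          have := Set.indicator_nonneg (s := ball (0 : EuclideanSpace ℝ (Fin n)) (R + 1)) (f := w)
            (fun y _ => hw0 y) x
          simp; positivity
      simp only [he1, he2, hval]
      linarith
    · have hval : (u + φ) x = ψ x := by rw [hsum]; simp [hux.le]
      have hgr : sgradSq (u + φ) x = sgradSq ψ x := by
        apply sgradSq_congr
        apply EventuallyEq.fderiv_eq
        have := (barr_cont (n := n) l K R).continuousAt.eventually_lt hu.continuous.continuousAt hux
        filter_upwards [this] with y hy
        rw [hsum]; exact min_eq_right hy.le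
      have hb := barr_grad l K R hK0 x
      rw [← hψ] at hb
      have hul := hψl x
      have huM := (abs_le.1 (hM x)).2
      have hxin : x ∈ ball (0 : EuclideanSpace ℝ (Fin n)) (R + 1) := by
        simp only [mem_ball, dist_zero_right]
        by_contra! hcon
        exact absurd (hout x hcon) (not_le.2 hux)
      have hwx : w x = u x - l := max_eq_left (by linarith)
      have hWu := hlev (u x) (by linarith) huM
      have hWψ := hL (ψ x) hul (by linarith)
      have hs := sgradSq_nonneg' u x
      have hkk : e2 x ≤ e1 x + (C * (ψ x - l) - δ * w x) := by
        simp only [he1, he2, hval, hgr, hwx, hC]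
        linarith
      have hCψ : C * (ψ x - l) ≤ C * w x := by rw [hwx]; gcongr
      have hδw : 0 ≤ δ * w x := mul_nonneg hδ.le (hw0 x)
      refine hkk.trans ?_
      simp only [hg, Set.indicator_of_mem hxin]
      by_cases hx : x ∈ ball (0 : EuclideanSpace ℝ (Fin n)) R
      · have hψx : ψ x = l := by
          simp only [hψ, barr]; rw [cutS_zero R x (mem_ball_zero_iff.1 hx).le]; simp
        rw [Set.indicator_of_mem hx, hψx]
        linarith
      · rw [Set.indicator_of_notMem hx]
        linarith
  have hgrc : Continuous (sgradSq u) := by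
    unfold sgradSq
    have := hu.continuous_fderiv one_ne_zero
    fun_prop
  have he1i : IntegrableOn e1 Ω := by
    have : Continuous e1 := by
      have h1 := hu.continuous
      have h2 := hW.continuous
      simp only [he1]; fun_prop
    exact (this.continuousOn.integrableOn_compact (isCompact_closedBall 0 (R + 2))).mono_set ball_subset_closedBall
  have hind : ∀ r, r ≤ R + 2 → IntegrableOn ((ball 0 r).indicator w) Ω := by
    intro r _
    exact (((hwi r).integrable_indicator measurableSet_ball)).integrableOn
  have hgi : IntegrableOn g Ω :=
    ((hind (R + 1) (by linarith)).const_mul C).sub ((hind R (by linarith)).const_mul (C + δ))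
  have he2m : Measurable e2 := by
    have h1 : Continuous (u + φ) := by
      rw [hsum]; exact hu.continuous.min (barr_cont l K R)
    simp only [he2]
    refine Measurable.add (Measurable.const_mul ?_ _) (hW.continuous.comp h1).measurable
    unfold sgradSq
    refine Finset.measurable_sum _ fun i _ => ?_
    exact ((measurable_fderiv_apply_const ℝ (u + φ) _).norm).pow_const 2
  have he2i : IntegrableOn e2 Ω := by
    refine Integrable.mono' (he1i.add hgi) he2m.aestronglyMeasurable (Eventually.of_forall fun x => ?_)
    have : 0 ≤ e2 x := by
      have := sgradSq_nonneg' (u + φ) x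
      have := hW0 ((u + φ) x)
      simp only [he2]; positivity
    rw [Real.norm_of_nonneg this]
    exact hpt x
  have h1 : ∫ x in Ω, e2 x ≤ ∫ x in Ω, (e1 x + g x) :=
    integral_mono he2i (he1i.add hgi) hpt
  rw [integral_add he1i hgi] at h1
  have h2 : (∫ x in Ω, e1 x) ≤ ∫ x in Ω, e2 x := hE
  have h3 : ∫ x in Ω, g x = C * (∫ x in ball 0 (R + 1), w x) - (C + δ) * ∫ x in ball 0 R, w x := by
    simp only [hg]
    rw [integral_sub ((hind (R + 1) (by linarith)).const_mul C) ((hind R (by linarith)).const_mul (C + δ)),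
      integral_const_mul, integral_const_mul, setIntegral_indicator measurableSet_ball,
      setIntegral_indicator measurableSet_ball,
      Set.inter_eq_right.2 (ball_subset_ball (by linarith)),
      Set.inter_eq_right.2 (ball_subset_ball (by linarith))]
  linarith

theorem one_sided {n : ℕ} (W : ℝ → ℝ) (hW : ContDiff ℝ 1 W)
    (a : ℝ) (hWa : W a = 0) (hWpos : ∀ v : ℝ, v ≠ a → 0 < W v)
    (u : EuclideanSpace ℝ (Fin n) → ℝ) (hu : ContDiff ℝ 1 u) (hbdd : ∃ C, ∀ x, |u x| ≤ C)
    (hmin : SGloballyMinimizing W u) (x₀) : u x₀ ≤ a := by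
  refine le_of_forall_pos_le_add fun ε hε => ?_
  obtain ⟨M₀, hM₀⟩ := hbdd
  set M := max M₀ a with hMdef
  have hM : ∀ x, |u x| ≤ M := fun x => (hM₀ x).trans (le_max_left _ _)
  obtain ⟨l, δ, hal, hlε, hlM, hδ, hlev⟩ :=
    level_exists W hW.continuous a M ε (le_max_right _ _) hε hWa hWpos
  have hW0 : ∀ t, 0 ≤ W t := by
    intro t
    by_cases h : t = a
    · rw [h, hWa]
    · exact (hWpos t h).le
  obtain ⟨L₀, hL₀⟩ := (isCompact_Icc (a := l) (b := M)).exists_bound_of_continuousOn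
    (hW.continuous_deriv le_rfl).continuousOn
  set L := |L₀| + 1 with hLd
  have hL0 : 0 < L := by positivity
  have hL : ∀ t, l ≤ t → t ≤ M → W t - W l ≤ L * (t - l) := by
    intro t h1 h2
    have := (convex_Icc l M).norm_image_sub_le_of_norm_deriv_le (f := W) (C := L)
      (fun z _ => (hW.differentiable one_ne_zero) z)
      (fun z hz => (hL₀ z hz).trans (by linarith [le_abs_self L₀]))
      (show l ∈ _ from ⟨le_rfl, hlM⟩) (show t ∈ _ from ⟨h1, h2⟩)
    rw [Real.norm_eq_abs, Real.norm_eq_abs, abs_of_nonneg (by linarith : 0 ≤ t - l)] at this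
    exact (le_abs_self _).trans this
  have hstep := step_ineq W hW hW0 u hu hmin M l δ L (M - l) hM hlM rfl hlev hδ hL0.le hL
  set C := 2 * n * (M - l) + L with hC
  have hC0 : 0 < C := by
    have : 0 ≤ M - l := by linarith
    positivity
  set w : EuclideanSpace ℝ (Fin n) → ℝ := fun x => max (u x - l) 0 with hw
  have hw0 : ∀ x, 0 ≤ w x := fun x => le_max_right _ _
  have hwc : Continuous w := by have := hu.continuous; fun_prop
  have hwi : ∀ r, IntegrableOn w (ball 0 r) := fun r =>
    (hwc.continuousOn.integrableOn_compact (isCompact_closedBall 0 r)).mono_set ball_subset_closedBall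
  set q := (C + δ) / C with hq
  have hq1 : 1 < q := by rw [hq, one_lt_div hC0]; linarith
  set F : ℕ → ℝ := fun k => ∫ x in ball (0 : EuclideanSpace ℝ (Fin n)) k, w x with hF
  have hFs : ∀ k, q * F k ≤ F (k + 1) := by
    intro k
    have := hstep k
    simp only [hF, hq, Nat.cast_add, Nat.cast_one]
    rw [div_mul_eq_mul_div, div_le_iff₀ hC0]
    linarith
  have hmono : Monotone fun k => F k / q ^ k := by
    refine monotone_nat_of_le_succ fun k => ?_
    rw [div_le_div_iff₀ (by positivity) (by positivity), pow_succ]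
    have := hFs k
    have hp : 0 < q ^ k := by positivity
    nlinarith
  set V := (volume (ball (0 : EuclideanSpace ℝ (Fin n)) 1)).toReal with hV
  have hFb : ∀ k : ℕ, 1 ≤ k → F k ≤ (M - l) * V * k ^ n := by
    intro k hk
    have hvol : (volume (ball (0 : EuclideanSpace ℝ (Fin n)) k)).toReal = k ^ n * V := by
      rw [Measure.addHaar_ball_of_pos volume _ (by exact_mod_cast hk)]
      simp [hV]
    calc F k ≤ ∫ x in ball (0 : EuclideanSpace ℝ (Fin n)) k, (M - l) := by
          refine setIntegral_mono (hwi k) (integrableOn_const measure_ball_lt_top.ne) fun x => ?_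
          refine max_le ?_ (by linarith)
          linarith [(abs_le.1 (hM x)).2]
      _ = _ := by
        rw [setIntegral_const, Measure.real, hvol, smul_eq_mul]; ring
  have hlim : Tendsto (fun k : ℕ => (M - l) * V * ((k : ℝ) ^ n / q ^ k)) atTop (nhds 0) := by
    simpa using (tendsto_pow_const_div_const_pow_of_one_lt n hq1).const_mul ((M - l) * V)
  have hF0 : ∀ N, F N ≤ 0 := by
    intro N
    have : F N / q ^ N ≤ 0 := by
      refine ge_of_tendsto hlim ?_
      filter_upwards [eventually_ge_atTop N, eventually_ge_atTop 1] with k h1 h2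
      refine (hmono h1).trans ?_
      simp only
      rw [← mul_div_assoc]
      gcongr
      exact hFb k h2
    rw [div_le_iff₀ (by positivity)] at this
    simpa using this
  suffices h : w x₀ ≤ 0 by
    have := (le_max_left (u x₀ - l) 0).trans h
    linarith
  by_contra! hpos
  obtain ⟨N, hN⟩ := exists_nat_gt ‖x₀‖
  have hposF : 0 < F N := by
    simp only [hF]
    rw [setIntegral_pos_iff_support_of_nonneg_ae (Eventually.of_forall hw0) (hwi N)]
    refine IsOpen.measure_pos volume (hwc.isOpen_support.inter isOpen_ball) ⟨x₀, hpos.ne', ?_⟩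
    simpa using hN
  linarith [hF0 N]

theorem min_neg {n : ℕ} (W : ℝ → ℝ) (u : EuclideanSpace ℝ (Fin n) → ℝ)
    (hmin : SGloballyMinimizing W u) : SGloballyMinimizing (fun t => W (-t)) (-u) := by
  have key : ∀ v : EuclideanSpace ℝ (Fin n) → ℝ, ∀ Ω,
      senergy (fun t => W (-t)) (-v) Ω = senergy W v Ω := by
    intro v Ω
    simp [senergy, sgradSq, fderiv_neg]
  rintro Ω h1 h2 φ ⟨k, hk⟩ hs
  have := hmin Ω h1 h2 (-φ) ⟨k, hk.neg⟩ (by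
    have : tsupport (-φ) = tsupport φ := by simp [tsupport, Function.support_neg]
    rwa [this])
  rw [key, show -u + φ = -(u + -φ) by abel, key]
  exact this

/-- Theorem 1.3, Case (a) (scalar case): for `m = 1` and `W ∈ C^{1,1}_loc(ℝ;ℝ)`
nonnegative, vanishing exactly at `a`, any bounded globally minimizing solution of
`Δu = W'(u)` on `ℝⁿ`, `n ≥ 2`, is identically `a`. -/
theorem liouville_scalar
    (n : ℕ) (hn : 2 ≤ n)
    (W : ℝ → ℝ) (hW : ContDiff ℝ 1 W) (hW' : LocallyLipschitz (deriv W))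
    (a : ℝ) (hWa : W a = 0) (hWpos : ∀ v : ℝ, v ≠ a → 0 < W v)
    (u : EuclideanSpace ℝ (Fin n) → ℝ)
    (hu : ContDiff ℝ 2 u)
    (hbdd : ∃ C, ∀ x, |u x| ≤ C)
    (hsol : ∀ x, slap u x = deriv W (u x))
    (hmin : SGloballyMinimizing W u) :
    ∀ x, u x = a := by
  have hu1 : ContDiff ℝ 1 u := hu.of_le (by norm_num)
  intro x
  refine le_antisymm (one_sided W hW a hWa hWpos u hu1 hbdd hmin x) ?_
  have h := one_sided (fun t => W (-t)) (hW.comp contDiff_neg) (-a) (by simpa using hWa)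
    (fun v hv => hWpos (-v) (fun h => hv (by rw [← h, neg_neg]))) (-u) hu1.neg
    (by simpa using hbdd) (min_neg W u hmin) x
  simpa using h
end

section
/- Let W ∈ C¹(ℝᵐ;ℝ), m ≥ 1, be nonnegative with W(u) > 0 for all u ≠ a and W(a) = 0 for some point a ∈ ℝᵐ. If u ∈ C²(ℝⁿ;ℝᵐ), n ≥ 2, is a bounded, globally minimizing solution of Δu = ∇W(u) on ℝⁿ which is radially symmetric (i.e. u(x) depends only on |x|), then u ≡ a. -/
open MeasureTheory Metric Filter RealInnerProductSpace

lemma aux_limit (n : ℕ) (c M r0 : ℝ) (hc : 0 < c)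
    (h : ∀ R : ℝ, r0 ≤ R → 0 ≤ R → c * ((R + 2) ^ n - r0 ^ n) ≤ M * ((R + 2) ^ n - R ^ n))
    (hn : 1 ≤ n) : False := by
  have h1 : Tendsto (fun R : ℝ => R / (R + 2)) atTop (nhds 1) := by
    have h2 : Tendsto (fun R : ℝ => 1 - 2 / (R + 2)) atTop (nhds (1 - 0)) := by
      refine Tendsto.sub tendsto_const_nhds ?_
      exact Tendsto.div_atTop tendsto_const_nhds (tendsto_atTop_add_const_right _ _ tendsto_id)
    rw [sub_zero] at h2
    refine h2.congr' ?_
    filter_upwards [eventually_gt_atTop 0] with R hR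
    field_simp
    ring
  have h3 : Tendsto (fun R : ℝ => r0 / (R + 2)) atTop (nhds 0) :=
    Tendsto.div_atTop tendsto_const_nhds (tendsto_atTop_add_const_right _ _ tendsto_id)
  have h4 : Tendsto (fun R : ℝ => c * (1 - (r0 / (R + 2)) ^ n)) atTop (nhds (c * (1 - 0 ^ n))) :=
    ((tendsto_const_nhds).sub (h3.pow n)).const_mul c
  have h5 : Tendsto (fun R : ℝ => M * (1 - (R / (R + 2)) ^ n)) atTop (nhds (M * (1 - 1 ^ n))) :=
    ((tendsto_const_nhds).sub (h1.pow n)).const_mul M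
  have h6 := le_of_tendsto_of_tendsto h4 h5 (by
    filter_upwards [eventually_gt_atTop 0, eventually_ge_atTop r0] with R hR hR0
    have := h R hR0 hR.le
    have hp : (0 : ℝ) < (R + 2) ^ n := by positivity
    rw [div_pow, div_pow, one_sub_div hp.ne', one_sub_div hp.ne', ← mul_div_assoc, ← mul_div_assoc]
    gcongr)
  have : (0 : ℝ) ^ n = 0 := zero_pow (by omega)
  rw [this] at h6
  simp at h6
  linarith

lemma aux_gradSq_le {n m : ℕ} (v : EuclideanSpace ℝ (Fin n) → EuclideanSpace ℝ (Fin m))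
    (K : NNReal) (hv : LipschitzWith K v) (x : EuclideanSpace ℝ (Fin n)) :
    gradSq v x ≤ n * (K : ℝ) ^ 2 := by
  unfold gradSq
  calc _ ≤ ∑ _i : Fin n, (K : ℝ) ^ 2 := by
        refine Finset.sum_le_sum fun i _ => ?_
        have h1 := (fderiv ℝ v x).le_opNorm (EuclideanSpace.single i 1)
        have h2 := norm_fderiv_le_of_lipschitz ℝ hv (x₀ := x)
        simp at h1
        gcongr
        exact h1.trans h2
    _ = _ := by simp

lemma aux_gradSq_nonneg {n m : ℕ} (v : EuclideanSpace ℝ (Fin n) → EuclideanSpace ℝ (Fin m))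
    (x : EuclideanSpace ℝ (Fin n)) : 0 ≤ gradSq v x :=
  Finset.sum_nonneg fun i _ => sq_nonneg _

lemma aux_energy {n m : ℕ} (hn : 1 ≤ n)
    (W : EuclideanSpace ℝ (Fin m) → ℝ) (hW : Continuous W) (hW0 : ∀ v, 0 ≤ W v)
    (a : EuclideanSpace ℝ (Fin m)) (hWa : W a = 0)
    (u : EuclideanSpace ℝ (Fin n) → EuclideanSpace ℝ (Fin m))
    (hu : ContDiff ℝ 1 u) (C : ℝ) (hC : ∀ x, ‖u x‖ ≤ C) (L : NNReal) (hL : LipschitzWith L u)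
    (hmin : GloballyMinimizing W u) (r0 c : ℝ) (hr0 : 0 ≤ r0) (hc : 0 < c)
    (hlow : ∀ x, r0 ≤ ‖x‖ → c ≤ W (u x)) : False := by
  have hC0 : 0 ≤ C := (norm_nonneg _).trans (hC 0)
  obtain ⟨B, hB⟩ : ∃ B, ∀ v : EuclideanSpace ℝ (Fin m), ‖v‖ ≤ C + (‖a‖ + C) → W v ≤ B := by
    obtain ⟨B, hB⟩ := (isCompact_closedBall (0 : EuclideanSpace ℝ (Fin m))
      (C + (‖a‖ + C))).bddAbove_image hW.continuousOn
    exact ⟨B, fun v hv => hB ⟨v, by simpa using hv, rfl⟩⟩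
  have hau : ∀ x, ‖a - u x‖ ≤ ‖a‖ + C := fun x =>
    (norm_sub_le _ _).trans (by linarith [hC x])
  let D : NNReal := ⟨‖a‖ + C, by positivity⟩
  set M : ℝ := (1 / 2) * (n * ((L + (D + L) : NNReal) : ℝ) ^ 2) + B with hM
  have hB0 : 0 ≤ B := (hW0 0).trans (hB 0 (by simp; positivity))
  have hM0 : 0 ≤ M := by positivity
  refine aux_limit n c M r0 hc ?_ hn
  intro R hr0R hR
  have : Nonempty (Fin n) := ⟨⟨0, hn⟩⟩
  let η : EuclideanSpace ℝ (Fin n) → ℝ := fun x => max 0 (min 1 (R + 1 - ‖x‖))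
  have hη0 : ∀ x, 0 ≤ η x := fun x => le_max_left _ _
  have hη1 : ∀ x, η x ≤ 1 := fun x => max_le zero_le_one (min_le_left _ _)
  have hηL : ∀ x y, |η x - η y| ≤ ‖x - y‖ := by
    intro x y
    have h1 : |η x - η y| ≤ |min 1 (R + 1 - ‖x‖) - min 1 (R + 1 - ‖y‖)| := by
      have := abs_max_sub_max_le_max 0 (min 1 (R + 1 - ‖x‖)) 0 (min 1 (R + 1 - ‖y‖))
      simpa using this
    have h2 : |min 1 (R + 1 - ‖x‖) - min 1 (R + 1 - ‖y‖)| ≤ |‖y‖ - ‖x‖| := by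
      have := abs_min_sub_min_le_max 1 (R + 1 - ‖x‖) 1 (R + 1 - ‖y‖)
      simpa using this
    refine h1.trans (h2.trans ?_)
    rw [norm_sub_rev]
    exact abs_norm_sub_norm_le y x
  let φ : EuclideanSpace ℝ (Fin n) → EuclideanSpace ℝ (Fin m) := fun x => η x • (a - u x)
  have hφL : LipschitzWith (D + L) φ := by
    refine LipschitzWith.of_dist_le_mul fun x y => ?_
    rw [dist_eq_norm, dist_eq_norm]
    have e : φ x - φ y = (η x - η y) • (a - u x) + η y • (u y - u x) := by
      simp only [φ]; module
    have hl : ‖u y - u x‖ ≤ L * ‖x - y‖ := by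
      have := hL.dist_le_mul y x
      rwa [dist_eq_norm, dist_eq_norm, norm_sub_rev y x] at this
    calc ‖φ x - φ y‖ ≤ |η x - η y| * ‖a - u x‖ + |η y| * ‖u y - u x‖ := by
          rw [e]; refine (norm_add_le _ _).trans ?_
          rw [norm_smul, norm_smul]; rfl
      _ ≤ ‖x - y‖ * (‖a‖ + C) + 1 * (L * ‖x - y‖) := by
          gcongr
          · exact hηL x y
          · exact hau x
          · rw [abs_of_nonneg (hη0 y)]; exact hη1 y
      _ = _ := by
          change _ = ((‖a‖ + C) + (L : ℝ)) * ‖x - y‖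
          ring
  have hsupp : tsupport φ ⊆ ball 0 (R + 2) := by
    have : tsupport φ ⊆ closedBall 0 (R + 1) := by
      refine closure_minimal ?_ isClosed_closedBall
      intro x hx
      by_contra hx'
      simp only [mem_closedBall, dist_zero_right, not_le] at hx'
      apply hx
      have : η x = 0 := by
        simp only [η]
        exact max_eq_left ((min_le_right _ _).trans (by linarith))
      simp [φ, this]
    refine this.trans (closedBall_subset_ball (by linarith))
  have key := hmin (ball 0 (R + 2)) isOpen_ball isBounded_ball φ ⟨_, hφL⟩ hsupp
  have hvL : LipschitzWith (L + (D + L)) (u + φ) := hL.add hφL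
  have hfin : volume (ball (0 : EuclideanSpace ℝ (Fin n)) (R + 2)) ≠ ⊤ := measure_ball_lt_top.ne
  have vol : ∀ r : ℝ, 0 ≤ r → volume.real (ball (0 : EuclideanSpace ℝ (Fin n)) r) =
      r ^ n * volume.real (ball (0 : EuclideanSpace ℝ (Fin n)) 1) := by
    intro r hr
    rw [Measure.real, Measure.real, Measure.addHaar_ball _ _ hr]
    simp [ENNReal.toReal_mul, ENNReal.toReal_ofReal (pow_nonneg hr n)]
  have indint : ∀ k r : ℝ, 0 ≤ r → r ≤ R + 2 →
      ∫ x in ball (0 : EuclideanSpace ℝ (Fin n)) (R + 2),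
        (ball (0 : EuclideanSpace ℝ (Fin n)) r)ᶜ.indicator (fun _ => k) x =
      k * ((R + 2) ^ n - r ^ n) * volume.real (ball (0 : EuclideanSpace ℝ (Fin n)) 1) := by
    intro k r hr hrR
    rw [setIntegral_indicator measurableSet_ball.compl, setIntegral_const,
      ← Set.sdiff_eq, measureReal_sdiff (ball_subset_ball hrR) measurableSet_ball,
      vol _ hr, vol _ (by linarith), smul_eq_mul]
    ring
  have indI : ∀ k r : ℝ, IntegrableOn ((ball (0 : EuclideanSpace ℝ (Fin n)) r)ᶜ.indicator
      (fun _ => k)) (ball 0 (R + 2)) := by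
    intro k r
    exact (integrableOn_const hfin).indicator measurableSet_ball.compl
  have up : energy W (u + φ) (ball 0 (R + 2)) ≤
      M * ((R + 2) ^ n - R ^ n) * volume.real (ball (0 : EuclideanSpace ℝ (Fin n)) 1) := by
    rw [← indint M R hR (by linarith)]
    unfold energy
    refine integral_mono_of_nonneg (Eventually.of_forall fun x => ?_) (indI M R)
      (Eventually.of_forall fun x => ?_)
    · have := aux_gradSq_nonneg (u + φ) x
      have := hW0 ((u + φ) x)
      simp only [Pi.zero_apply]
      positivity
    · by_cases hx : x ∈ ball (0 : EuclideanSpace ℝ (Fin n)) R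
      · have heq : ∀ y ∈ ball (0 : EuclideanSpace ℝ (Fin n)) R, (u + φ) y = a := by
          intro y hy
          have hy' : ‖y‖ < R := by simpa using hy
          have : η y = 1 := by
            simp only [η]
            rw [min_eq_left (by linarith), max_eq_right zero_le_one]
          simp [φ, this]
        have hev : (u + φ) =ᶠ[nhds x] fun _ => a := by
          filter_upwards [isOpen_ball.mem_nhds hx] with y hy using heq y hy
        have hg : gradSq (u + φ) x = 0 := by
          unfold gradSq
          rw [hev.fderiv_eq]
          simp
        simp only [hg, heq x hx, hWa]
        simp [hx]
      · rw [Set.indicator_of_mem (show x ∈ (ball 0 R)ᶜ from hx)]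
        have h1 := aux_gradSq_le _ _ hvL x
        have h2 : W ((u + φ) x) ≤ B := by
          apply hB
          refine (norm_add_le _ _).trans (add_le_add (hC x) ?_)
          simp only [φ]
          rw [norm_smul, Real.norm_eq_abs, abs_of_nonneg (hη0 x)]
          calc _ ≤ 1 * (‖a‖ + C) := by
                gcongr
                · exact hη1 x
                · exact hau x
            _ = _ := one_mul _
        rw [hM]
        linarith
  have lo : c * ((R + 2) ^ n - r0 ^ n) * volume.real (ball (0 : EuclideanSpace ℝ (Fin n)) 1) ≤
      energy W u (ball 0 (R + 2)) := by
    rw [← indint c r0 hr0 (by linarith)]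
    unfold energy
    refine integral_mono (indI c r0) ?_ fun x => ?_
    · have hcont : Continuous fun x => (1 / 2) * gradSq u x + W (u x) := by
        unfold gradSq
        have := hu.continuous_fderiv (by norm_num)
        have := hu.continuous
        fun_prop
      exact (hcont.continuousOn.integrableOn_compact (isCompact_closedBall 0 (R + 2))).mono_set
        ball_subset_closedBall
    · have h1 := aux_gradSq_nonneg u x
      have h2 := hW0 (u x)
      by_cases hx : x ∈ ball (0 : EuclideanSpace ℝ (Fin n)) r0
      · simp only [Set.mem_compl_iff, hx, not_true_eq_false, not_false_eq_true,
          Set.indicator_of_notMem]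
        positivity
      · rw [Set.indicator_of_mem (show x ∈ (ball 0 r0)ᶜ from hx)]
        have := hlow x (by simpa using hx)
        linarith
  have hv1 : 0 < volume.real (ball (0 : EuclideanSpace ℝ (Fin n)) 1) :=
    ENNReal.toReal_pos (measure_ball_pos _ _ one_pos).ne' measure_ball_lt_top.ne
  exact le_of_mul_le_mul_right (lo.trans (key.trans up)) hv1

lemma aux_norm {n : ℕ} (y : EuclideanSpace ℝ (Fin n)) (hy : y ≠ 0) :
    HasFDerivAt (fun x : EuclideanSpace ℝ (Fin n) => ‖x‖) (‖y‖⁻¹ • innerSL ℝ y) y := by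
  have h0 : ‖y‖ ≠ 0 := norm_ne_zero_iff.mpr hy
  have h := (hasStrictFDerivAt_norm_sq y).hasFDerivAt.sqrt (pow_ne_zero 2 h0)
  simp only [Real.sqrt_sq (norm_nonneg _)] at h
  refine h.congr_fderiv ?_
  ext w
  simp
  field_simp

lemma aux_fderiv {n m : ℕ} (u : EuclideanSpace ℝ (Fin n) → EuclideanSpace ℝ (Fin m))
    (U : ℝ → EuclideanSpace ℝ (Fin m)) (hU : Differentiable ℝ U) (huU : ∀ x, u x = U ‖x‖)
    (y : EuclideanSpace ℝ (Fin n)) (hy : y ≠ 0) (i : Fin n) :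
    fderiv ℝ u y (EuclideanSpace.single i 1) = y i • (‖y‖⁻¹ • deriv U ‖y‖) := by
  have h1 : HasFDerivAt (fun x : EuclideanSpace ℝ (Fin n) => ‖x‖) (‖y‖⁻¹ • innerSL ℝ y) y :=
    aux_norm y hy
  have h2 := HasFDerivAt.comp (g := U) (f := fun x : EuclideanSpace ℝ (Fin n) => ‖x‖) y
    (hU ‖y‖).hasDerivAt.hasFDerivAt h1
  have h3 : u = U ∘ fun x => ‖x‖ := funext huU
  rw [h3, h2.fderiv]
  simp [EuclideanSpace.inner_single_right, smul_smul, mul_comm]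

lemma aux_lap {n m : ℕ} (u : EuclideanSpace ℝ (Fin n) → EuclideanSpace ℝ (Fin m))
    (hu : ContDiff ℝ 2 u) (i0 : Fin n)
    (U : ℝ → EuclideanSpace ℝ (Fin m))
    (hUdef : ∀ t, U t = u (t • EuclideanSpace.single i0 1)) (hU : ContDiff ℝ 2 U)
    (huU : ∀ x, u x = U ‖x‖) (t : ℝ) (ht : 0 < t) :
    vlap u (t • EuclideanSpace.single i0 1) =
      deriv (deriv U) t + ((n : ℝ) - 1) • (t⁻¹ • deriv U t) := by
  set e : EuclideanSpace ℝ (Fin n) := EuclideanSpace.single i0 1 with he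
  have hnorm : ‖t • e‖ = t := by rw [norm_smul]; simp [he, abs_of_pos ht]
  have hne : t • e ≠ 0 := by rw [← norm_pos_iff, hnorm]; exact ht
  have hU1 : Differentiable ℝ U := hU.differentiable (by norm_num)
  have hU2 : Differentiable ℝ (deriv U) :=
    (ContDiff.iterate_deriv' 1 1 hU).differentiable (by norm_num)
  have hu1 : Differentiable ℝ u := hu.differentiable (by norm_num)
  have hfd : ContDiff ℝ 1 (fderiv ℝ u) := hu.fderiv_right (by norm_num)
  have hfd1 : Differentiable ℝ (fderiv ℝ u) := hfd.differentiable (by norm_num)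
  have hline : ∀ s : ℝ, HasDerivAt (fun s : ℝ => s • e) e s := fun s => by
    simpa using (hasDerivAt_id s).smul_const e
  have hUd : ∀ s, deriv U s = fderiv ℝ u (s • e) e := by
    intro s
    have h := (hu1 (s • e)).hasFDerivAt.comp_hasDerivAt s (hline s)
    have h' : U = u ∘ fun s : ℝ => s • e := funext hUdef
    rw [h', h.deriv]
  have hterm0 : fderiv ℝ (fun y => fderiv ℝ u y e) (t • e) e = deriv (deriv U) t := by
    have hd : Differentiable ℝ (fun y => fderiv ℝ u y e) := by fun_prop
    have h := (hd (t • e)).hasFDerivAt.comp_hasDerivAt t (hline t)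
    have h' : deriv U = (fun y => fderiv ℝ u y e) ∘ fun s : ℝ => s • e := funext hUd
    rw [h', h.deriv]
  have hterm : ∀ i, i ≠ i0 → fderiv ℝ (fun y => fderiv ℝ u y (EuclideanSpace.single i 1)) (t • e)
      (EuclideanSpace.single i 1) = t⁻¹ • deriv U t := by
    intro i hi
    have hev : (fun y => fderiv ℝ u y (EuclideanSpace.single i 1)) =ᶠ[nhds (t • e)]
        fun y => y i • (‖y‖⁻¹ • deriv U ‖y‖) := by
      filter_upwards [isOpen_ne.mem_nhds hne] with y hy
      exact aux_fderiv u U hU1 huU y hy i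
    rw [hev.fderiv_eq]
    have hn1 : DifferentiableAt ℝ (fun x : EuclideanSpace ℝ (Fin n) => ‖x‖) (t • e) :=
      (aux_norm _ hne).differentiableAt
    have hh : DifferentiableAt ℝ (fun y : EuclideanSpace ℝ (Fin n) => ‖y‖⁻¹ • deriv U ‖y‖)
        (t • e) := by
      refine DifferentiableAt.smul (hn1.inv (by rw [hnorm]; exact ht.ne')) ?_
      exact (hU2 _).comp (t • e) hn1
    have hg : HasFDerivAt (fun y : EuclideanSpace ℝ (Fin n) => y i)
        (EuclideanSpace.proj i : EuclideanSpace ℝ (Fin n) →L[ℝ] ℝ) (t • e) :=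
      (EuclideanSpace.proj i : EuclideanSpace ℝ (Fin n) →L[ℝ] ℝ).hasFDerivAt
    have hfin := (hg.smul hh.hasFDerivAt).fderiv
    change fderiv ℝ (fun y : EuclideanSpace ℝ (Fin n) => y i • (‖y‖⁻¹ • deriv U ‖y‖)) _ = _ at hfin
    rw [hfin, hnorm]
    simp [he, hi]
  unfold vlap
  rw [← Finset.add_sum_erase _ _ (Finset.mem_univ i0), ← he, hterm0,
    Finset.sum_congr rfl (fun i hi => hterm i (Finset.ne_of_mem_erase hi))]
  rw [Finset.sum_const, Finset.card_erase_of_mem (Finset.mem_univ i0), Finset.card_univ,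
    Fintype.card_fin, ← Nat.cast_smul_eq_nsmul ℝ, Nat.cast_sub (Fin.pos i0)]
  simp

theorem liouville_radial
    (n m : ℕ) (hn : 2 ≤ n) (hm : 1 ≤ m)
    (W : EuclideanSpace ℝ (Fin m) → ℝ) (hW : ContDiff ℝ 1 W)
    (a : EuclideanSpace ℝ (Fin m))
    (hWa : W a = 0) (hWpos : ∀ v, v ≠ a → 0 < W v)
    (u : EuclideanSpace ℝ (Fin n) → EuclideanSpace ℝ (Fin m))
    (hu : ContDiff ℝ 2 u)
    (hbdd : ∃ C, ∀ x, ‖u x‖ ≤ C)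
    (hsol : ∀ x, vlap u x = gradient W (u x))
    (hmin : GloballyMinimizing W u)
    (hradial : ∀ x y : EuclideanSpace ℝ (Fin n), ‖x‖ = ‖y‖ → u x = u y) :
    ∀ x, u x = a := by
  obtain ⟨C, hC⟩ := hbdd
  have hW0 : ∀ v, 0 ≤ W v := by
    intro v
    by_cases h : v = a
    · rw [h, hWa]
    · exact (hWpos v h).le
  let i0 : Fin n := ⟨0, by omega⟩
  set e : EuclideanSpace ℝ (Fin n) := EuclideanSpace.single i0 1 with he
  have he1 : ‖e‖ = 1 := by simp [he]
  obtain ⟨U, hUdef⟩ : ∃ U : ℝ → EuclideanSpace ℝ (Fin m), ∀ t, U t = u (t • e) := ⟨_, fun _ => rfl⟩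
  have hUc : ContDiff ℝ 2 U := by
    have : U = fun t => u (t • e) := funext hUdef
    rw [this]
    exact hu.comp (contDiff_id.smul contDiff_const)
  have huU : ∀ x, u x = U ‖x‖ := by
    intro x
    rw [hUdef]
    apply hradial
    rw [norm_smul, he1]; simp
  have hU1 : Differentiable ℝ U := hUc.differentiable (by norm_num)
  have hU2 : Differentiable ℝ (deriv U) :=
    (ContDiff.iterate_deriv' 1 1 hUc).differentiable (by norm_num)
  have hWd : Differentiable ℝ W := hW.differentiable (by norm_num)
  let D : ℝ → ℝ := fun t => W (U t) - (1 / 2) * ‖deriv U t‖ ^ 2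
  have hD : ∀ t, 0 < t → HasDerivAt D (((n : ℝ) - 1) * t⁻¹ * ‖deriv U t‖ ^ 2) t := by
    intro t ht
    have h1 : HasDerivAt (fun s => W (U s)) (inner ℝ (gradient W (U t)) (deriv U t)) t := by
      have := (hWd (U t)).hasFDerivAt.comp_hasDerivAt t (hU1 t).hasDerivAt
      refine HasDerivAt.congr_deriv this ?_
      simp [gradient]
    have h2 := ((hU2 t).hasDerivAt.norm_sq).const_mul (1 / 2)
    have h3 := h1.sub h2
    refine h3.congr_deriv ?_
    have h4 := aux_lap u hu i0 U hUdef hUc huU t ht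
    rw [hsol, ← he, ← hUdef] at h4
    rw [h4, inner_add_left, inner_smul_left, inner_smul_left, real_inner_self_eq_norm_sq,
      real_inner_comm]
    simp
    ring
  have hn1 : (0 : ℝ) < (n : ℝ) - 1 := by
    have : (2 : ℝ) ≤ n := by exact_mod_cast hn
    linarith
  have hDc : Continuous D := by
    have := hU1.continuous
    have := hU2.continuous
    have := hWd.continuous
    fun_prop
  have hmono : MonotoneOn D (Set.Ici 0) := by
    refine monotoneOn_of_deriv_nonneg (convex_Ici 0) hDc.continuousOn ?_ ?_
    · intro t ht
      rw [interior_Ici] at ht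
      exact (hD t ht).differentiableAt.differentiableWithinAt
    · intro t ht
      rw [interior_Ici] at ht
      rw [(hD t ht).deriv]
      have : 0 < t := ht
      positivity
  have hD0 : 0 ≤ D 0 := by
    have hz : deriv U 0 = 0 := by
      have heven : (fun t => U (-t)) = U := by
        funext t
        rw [hUdef, hUdef]
        apply hradial
        simp
      have h := deriv_comp_neg U 0
      rw [heven, neg_zero] at h
      have h' : (2 : ℝ) • deriv U 0 = 0 := by
        rw [two_smul]; nth_rewrite 1 [h]; simp
      exact (smul_eq_zero.mp h').resolve_left two_ne_zero
    simp only [D, hz]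
    simpa using hW0 (U 0)
  obtain ⟨B, hB⟩ : ∃ B, ∀ v : EuclideanSpace ℝ (Fin m), ‖v‖ ≤ C → W v ≤ B := by
    obtain ⟨B, hB⟩ := (isCompact_closedBall (0 : EuclideanSpace ℝ (Fin m))
      C).bddAbove_image hW.continuous.continuousOn
    exact ⟨B, fun v hv => hB ⟨v, by simpa using hv, rfl⟩⟩
  have hDnn : ∀ t, 0 ≤ t → 0 ≤ D t := fun t ht =>
    hD0.trans (hmono Set.self_mem_Ici ht ht)
  have hder : ∀ t, 0 ≤ t → ‖deriv U t‖ ≤ Real.sqrt (2 * B) := by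
    intro t ht
    apply Real.le_sqrt_of_sq_le
    have h1 := hDnn t ht
    have h2 : W (U t) ≤ B := hB _ (by rw [hUdef]; exact hC _)
    simp only [D] at h1
    linarith
  let L : NNReal := ⟨Real.sqrt (2 * B), Real.sqrt_nonneg _⟩
  have hUL : LipschitzOnWith L U (Set.Ici 0) :=
    (convex_Ici 0).lipschitzOnWith_of_nnnorm_deriv_le (fun t _ => hU1 t) (fun t ht => hder t ht)
  have hL : LipschitzWith L u := by
    refine LipschitzWith.of_dist_le_mul fun x y => ?_
    rw [huU x, huU y]
    refine (hUL.dist_le_mul _ (norm_nonneg x) _ (norm_nonneg y)).trans ?_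
    gcongr
    rw [dist_eq_norm, dist_eq_norm]
    exact abs_norm_sub_norm_le x y
  have hDle : ∀ t, 0 ≤ t → D t ≤ 0 := by
    intro t ht
    by_contra hcon
    push Not at hcon
    refine aux_energy (by omega) W hW.continuous hW0 a hWa u (hu.of_le (by norm_num)) C hC L hL hmin
      t (D t) ht hcon ?_
    intro x hx
    rw [huU x]
    refine (hmono ht (norm_nonneg x) hx).trans ?_
    simp only [D]
    have := sq_nonneg ‖deriv U ‖x‖‖
    linarith
  have hpos : ∀ t, 0 < t → U t = a := by
    intro t ht
    have hev : D =ᶠ[nhds t] fun _ => 0 := by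
      filter_upwards [isOpen_Ioi.mem_nhds ht] with s hs
      exact le_antisymm (hDle s (le_of_lt hs)) (hDnn s (le_of_lt hs))
    have h1 := (hD t ht).deriv
    rw [hev.deriv_eq] at h1
    simp only [deriv_const] at h1
    have h2 : ‖deriv U t‖ ^ 2 = 0 := by
      have : ((n : ℝ) - 1) * t⁻¹ ≠ 0 := by positivity
      exact (mul_eq_zero.mp h1.symm).resolve_left this
    have h3 := hDle t ht.le
    simp only [D, h2] at h3
    by_contra hcon
    have := hWpos _ hcon
    linarith
  intro x
  have hcl : Set.EqOn U (fun _ => a) (closure (Set.Ioi 0)) :=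
    Set.EqOn.closure (fun t ht => hpos t ht) hU1.continuous continuous_const
  rw [closure_Ioi] at hcl
  rw [huU x]
  exact hcl (norm_nonneg x)
end
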